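/- Let d ∈ ℕ, 2 ≤ p < ∞ and r ≥ 0. Then there is a constant C > 0 such that for every f ∈ S^{r+1−2/p}_p A one has ‖f‖_{S^r_p W} ≤ C · ‖f‖_{S^{r+1−2/p}_p A}, i.e. S^{r+1−2/p}_p A ↪ S^r_p W. -/

import Mathlib

open MeasureTheory Real ENNReal

noncomputable section

namespace Paper

/-- The fundamental domain `[0,1)^d` of the `d`-dimensional torus `𝕋^d`. -/
def cube (d : ℕ) : Set (Fin d → ℝ) := Set.univ.pi fun _ => Set.Ico (0:ℝ) 1

/-- The trigonometric character `x ↦ e^{2π i k·x}`. -/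
def expk (d : ℕ) (k : Fin d → ℤ) (x : Fin d → ℝ) : ℂ :=
  Complex.exp (((2 * Real.pi * ∑ i, (k i : ℝ) * x i : ℝ) : ℂ) * Complex.I)

/-- Fourier coefficient `f̂(k) = ∫_{[0,1)^d} f(x) e^{-2π i k·x} dx`. -/
def fCoeff (d : ℕ) (f : (Fin d → ℝ) → ℂ) (k : Fin d → ℤ) : ℂ :=
  ∫ x in cube d, f x * expk d (-k) x

/-- The `L_q` (quasi-)norm on the torus, `q ∈ (0,∞]`, valued in `ℝ≥0∞`
(for `q = ∞` this is the essential supremum). -/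
def LqNorm (d : ℕ) (q : ℝ≥0∞) (f : (Fin d → ℝ) → ℂ) : ℝ≥0∞ :=
  eLpNorm f q (volume.restrict (cube d))

/-- The weight `∏_{i=1}^d (1+|k_i|)`. -/
def wt (d : ℕ) (k : Fin d → ℤ) : ℝ := ∏ i, (1 + |(k i : ℝ)|)

/-- The weighted Wiener (quasi-)norm `‖f‖_{S^r_θ A}`
(with the sup modification for `θ = ∞`); `A_θ` corresponds to `r = 0`,
the Wiener algebra `A` to `r = 0`, `θ = 1`. -/
def wienerNorm (d : ℕ) (r : ℝ) (θ : ℝ≥0∞) (f : (Fin d → ℝ) → ℂ) : ℝ≥0∞ :=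
  if θ = ∞ then ⨆ k : Fin d → ℤ, ENNReal.ofReal (wt d k ^ r) * (‖fCoeff d f k‖₊ : ℝ≥0∞)
  else (∑' k : Fin d → ℤ,
      (ENNReal.ofReal (wt d k ^ r) * (‖fCoeff d f k‖₊ : ℝ≥0∞)) ^ θ.toReal) ^ (1 / θ.toReal)

/-- Trigonometric polynomials with at most `m` terms. -/
def trigPoly (d m : ℕ) : Set ((Fin d → ℝ) → ℂ) :=
  {s | ∃ (Λ : Finset (Fin d → ℤ)) (a : (Fin d → ℤ) → ℂ),
    Λ.card ≤ m ∧ s = fun x => ∑ k ∈ Λ, a k * expk d k x}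

/-- Best `m`-term trigonometric approximation error of `f`, error measured by `X`. -/
def sigmaF (d m : ℕ) (X : ((Fin d → ℝ) → ℂ) → ℝ≥0∞) (f : (Fin d → ℝ) → ℂ) : ℝ≥0∞ :=
  ⨅ s ∈ trigPoly d m, X (f - s)

/-- The unit ball of the space (inside `L₁(𝕋^d)`) with (quasi-)norm `N`. -/
def unitBall (d : ℕ) (N : ((Fin d → ℝ) → ℂ) → ℝ≥0∞) : Set ((Fin d → ℝ) → ℂ) :=
  {f | IntegrableOn f (cube d) ∧ N f ≤ 1}

/-- Best `m`-term trigonometric width of the unit ball of `N`, error measured by `X`. -/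
def sigmaClass (d m : ℕ) (N X : ((Fin d → ℝ) → ℂ) → ℝ≥0∞) : ℝ≥0∞ :=
  ⨆ f ∈ unitBall d N, sigmaF d m X f

/-- `log*(m) = max (log₂ m) 1`. -/
def logStar (m : ℕ) : ℝ := max (Real.logb 2 m) 1

/-- Two-sided asymptotic equivalence `a_m ≍ b_m`. -/
def IsAsympEquiv (a : ℕ → ℝ≥0∞) (b : ℕ → ℝ) : Prop :=
  ∃ c C : ℝ, 0 < c ∧ 0 < C ∧ ∃ m₀ : ℕ, ∀ m : ℕ, m₀ ≤ m →
    ENNReal.ofReal (c * b m) ≤ a m ∧ a m ≤ ENNReal.ofReal (C * b m)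

/-- One-sided asymptotic bound `a_m ≲ b_m`. -/
def IsAsympLe (a : ℕ → ℝ≥0∞) (b : ℕ → ℝ) : Prop :=
  ∃ C : ℝ, 0 < C ∧ ∃ m₀ : ℕ, ∀ m : ℕ, m₀ ≤ m → a m ≤ ENNReal.ofReal (C * b m)

/-- Dyadic block `I_0 = {0}`, `I_n = {k : 2^{n-1} ≤ |k| < 2^n}` for `n ≥ 1`. -/
def blockF (n : ℕ) : Finset ℤ :=
  (Finset.Icc (-(2^n : ℤ)) (2^n)).filter fun k =>
    (n = 0 ∧ k = 0) ∨ (n ≠ 0 ∧ 2^(n-1) ≤ |k| ∧ |k| < 2^n)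

/-- The dyadic block projection `∑_{k ∈ I_j} f̂(k) e^{2π i k·x}`. -/
def blockProj (d : ℕ) (f : (Fin d → ℝ) → ℂ) (j : Fin d → ℕ) : (Fin d → ℝ) → ℂ :=
  fun x => ∑ k ∈ Fintype.piFinset (fun i => blockF (j i)), fCoeff d f k * expk d k x

/-- The mixed-smoothness Besov (quasi-)norm `‖f‖_{S^s_{p,θ}B}`
(with the sup modification for `θ = ∞`). -/
def besovNorm (d : ℕ) (s : ℝ) (p θ : ℝ≥0∞) (f : (Fin d → ℝ) → ℂ) : ℝ≥0∞ :=
  if θ = ∞ then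
    ⨆ j : Fin d → ℕ,
      ENNReal.ofReal ((2:ℝ) ^ (((∑ i, j i : ℕ) : ℝ) * s)) * LqNorm d p (blockProj d f j)
  else
    (∑' j : Fin d → ℕ,
      (ENNReal.ofReal ((2:ℝ) ^ (((∑ i, j i : ℕ) : ℝ) * s)) * LqNorm d p (blockProj d f j))
        ^ θ.toReal) ^ (1 / θ.toReal)

/-- The mixed-smoothness Sobolev norm `‖f‖_{S^s_p W}` (Littlewood–Paley form),
with `S^0_p W := L_p`. -/
def sobolevNorm (d : ℕ) (s : ℝ) (p : ℝ≥0∞) (f : (Fin d → ℝ) → ℂ) : ℝ≥0∞ :=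
  if s = 0 then LqNorm d p f
  else
    (∫⁻ x in cube d,
      ((∑' j : Fin d → ℕ,
        (ENNReal.ofReal ((2:ℝ) ^ (((∑ i, j i : ℕ) : ℝ) * s)) *
          (‖blockProj d f j x‖₊ : ℝ≥0∞)) ^ (2:ℕ)) ^ ((1:ℝ)/2)) ^ p.toReal) ^ (1 / p.toReal)

/-- Trigonometric polynomials with frequencies in `[-M,M]^d`. -/
def boxPoly (d M : ℕ) : Set ((Fin d → ℝ) → ℂ) :=
  {s | ∃ (Λ : Finset (Fin d → ℤ)) (a : (Fin d → ℤ) → ℂ),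
    (∀ k ∈ Λ, ∀ i, |k i| ≤ (M : ℤ)) ∧ s = fun x => ∑ k ∈ Λ, a k * expk d k x}

/-- Error of best approximation by trigonometric polynomials with
frequencies in `[-M,M]^d`, measured in `L_∞`. -/
def EBox (d M : ℕ) (f : (Fin d → ℝ) → ℂ) : ℝ≥0∞ :=
  ⨅ g ∈ boxPoly d M, LqNorm d ∞ (f - g)

/-- The `m`-th (non-linear) sampling width of the class of continuous functions
in the unit ball of `N`, error measured in `L_q`. -/
def samplingWidth (d m : ℕ) (N : ((Fin d → ℝ) → ℂ) → ℝ≥0∞) (q : ℝ≥0∞) : ℝ≥0∞ :=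
  ⨅ (t : Fin m → (Fin d → ℝ)) (_ : ∀ i, t i ∈ cube d)
    (R : (Fin m → ℂ) → ((Fin d → ℝ) → ℂ)),
    ⨆ f ∈ {f : (Fin d → ℝ) → ℂ | Continuous f ∧ N f ≤ 1},
      LqNorm d q (f - R fun i => f (t i))

/-- If partial sums are dominated by `u`, the `p`-th power of the total is controlled by a
square of a tail times a power of an initial sum of `u`. -/
lemma norm_sum_rpow_le_tail {E : Type*} [NormedAddCommGroup E] (N : ℕ) (F : ℕ → E) (u : ℕ → ℝ)
    (hu : ∀ l, ‖F l‖ ≤ u l) {P : ℝ} (hP : 2 < P) :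
    ‖∑ l ∈ Finset.range N, F l‖ ^ P ≤
      2 ^ P * ∑ J ∈ Finset.range N, ‖∑ l ∈ Finset.Ico J N, F l‖ ^ 2 *
        (∑ l ∈ Finset.range (J + 1), u l) ^ (P - 2) := by
  have hu0 : ∀ l, 0 ≤ u l := fun l => (norm_nonneg _).trans (hu l)
  have hU0 : ∀ J, 0 ≤ ∑ l ∈ Finset.range J, u l := fun J => Finset.sum_nonneg fun l _ => hu0 l
  set S := ‖∑ l ∈ Finset.range N, F l‖ with hS
  have hterm : ∀ J, 0 ≤ ‖∑ l ∈ Finset.Ico J N, F l‖ ^ 2 *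
        (∑ l ∈ Finset.range (J + 1), u l) ^ (P - 2) := fun J =>
    mul_nonneg (sq_nonneg _) (Real.rpow_nonneg (hU0 _) _)
  have hS0 : 0 ≤ S := norm_nonneg _
  rcases hS0.eq_or_lt with h0 | h0
  · rw [← h0, Real.zero_rpow (by linarith)]
    exact mul_nonneg (by positivity) (Finset.sum_nonneg fun J _ => hterm J)
  have hbig : ∀ n, (∀ J < n, ∑ l ∈ Finset.range (J + 1), u l < S / 2) →
      ∑ l ∈ Finset.range n, u l < S / 2 := by
    intro n hn
    cases n with
    | zero => simpa using h0
    | succ m => exact hn m (Nat.lt_succ_self m)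
  have hNle : S ≤ ∑ l ∈ Finset.range N, u l :=
    (norm_sum_le _ _).trans (Finset.sum_le_sum fun l _ => hu l)
  have hex : ∃ J, J < N ∧ S / 2 ≤ ∑ l ∈ Finset.range (J + 1), u l := by
    by_contra! hcon
    linarith [hbig N hcon]
  classical
  obtain ⟨hJN, hJ⟩ := Nat.find_spec hex
  set J := Nat.find hex
  have hlt : ∑ l ∈ Finset.range J, u l < S / 2 := by
    refine hbig J fun i hi => ?_
    have := Nat.find_min hex hi
    push Not at this
    exact this (hi.trans hJN)
  have htail : S / 2 ≤ ‖∑ l ∈ Finset.Ico J N, F l‖ := by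
    have h1 : ∑ l ∈ Finset.range N, F l =
        ∑ l ∈ Finset.range J, F l + ∑ l ∈ Finset.Ico J N, F l :=
      (Finset.sum_range_add_sum_Ico F hJN.le).symm
    have h2 : S ≤ ‖∑ l ∈ Finset.range J, F l‖ + ‖∑ l ∈ Finset.Ico J N, F l‖ := by
      rw [hS, h1]; exact norm_add_le _ _
    have h3 : ‖∑ l ∈ Finset.range J, F l‖ ≤ ∑ l ∈ Finset.range J, u l :=
      (norm_sum_le _ _).trans (Finset.sum_le_sum fun l _ => hu l)
    linarith
  have hsplit : S ^ P = 2 ^ P * ((S / 2) ^ 2 * (S / 2) ^ (P - 2)) := by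
    rw [← Real.rpow_natCast, ← Real.rpow_add (by positivity), Nat.cast_ofNat,
      add_sub_cancel, ← Real.mul_rpow (by positivity) (by positivity),
      mul_div_cancel₀ _ (by norm_num)]
  rw [hsplit]
  refine mul_le_mul_of_nonneg_left ?_ (by positivity)
  refine le_trans ?_ (Finset.single_le_sum (fun i _ => hterm i) (Finset.mem_range.2 hJN))
  gcongr

lemma sum_pow_dist_le {q : ℝ} (hq0 : 0 < q) (hq1 : q < 1) (N J : ℕ) :
    ∑ l ∈ Finset.range N, q ^ ((J - l) + (l - J)) ≤ 2 / (1 - q) := by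
  have hgeo : ∀ s : Finset ℕ, ∑ i ∈ s, q ^ i ≤ 1 / (1 - q) := by
    intro s
    rw [one_div, ← tsum_geometric_of_lt_one hq0.le hq1]
    exact (summable_geometric_of_lt_one hq0.le hq1).sum_le_tsum s fun i _ => by positivity
  have h1 : ∑ l ∈ (Finset.range N).filter (· ≤ J), q ^ ((J - l) + (l - J)) ≤ 1 / (1 - q) := by
    rw [← Finset.sum_image (s := (Finset.range N).filter (· ≤ J))
      (g := fun l => (J - l) + (l - J)) (f := fun i => q ^ i)]
    · exact hgeo _
    · intro a ha b hb hab
      simp at ha hb hab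
      omega
  have h2 : ∑ l ∈ (Finset.range N).filter (¬ · ≤ J), q ^ ((J - l) + (l - J)) ≤ 1 / (1 - q) := by
    rw [← Finset.sum_image (s := (Finset.range N).filter (¬ · ≤ J))
      (g := fun l => (J - l) + (l - J)) (f := fun i => q ^ i)]
    · exact hgeo _
    · intro a ha b hb hab
      simp at ha hb hab
      omega
  rw [← Finset.sum_filter_add_sum_filter_not _ (· ≤ J)]
  calc _ ≤ 1 / (1 - q) + 1 / (1 - q) := add_le_add h1 h2
    _ = _ := by ring

/-- Discrete Young inequality for convolution with a two-sided geometric kernel. -/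
lemma sum_rpow_geometric_conv_le {q : ℝ} (hq0 : 0 < q) (hq1 : q < 1) {P : ℝ} (hP : 1 ≤ P)
    (N : ℕ) (b : ℕ → ℝ) (hb : ∀ l, 0 ≤ b l) :
    ∑ J ∈ Finset.range N, (∑ l ∈ Finset.range N, q ^ ((J - l) + (l - J)) * b l) ^ P ≤
      (2 / (1 - q)) ^ P * ∑ l ∈ Finset.range N, b l ^ P := by
  set K := 2 / (1 - q) with hK
  have hK0 : 0 < K := div_pos two_pos (by linarith)
  have hw : ∀ J l : ℕ, 0 ≤ q ^ ((J - l) + (l - J)) := fun J l => by positivity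
  have hrow : ∀ J, (∑ l ∈ Finset.range N, q ^ ((J - l) + (l - J)) * b l) ^ P ≤
      K ^ (P - 1) * ∑ l ∈ Finset.range N, q ^ ((J - l) + (l - J)) * b l ^ P := by
    intro J
    have hB : 0 ≤ ∑ l ∈ Finset.range N, q ^ ((J - l) + (l - J)) * b l ^ P :=
      Finset.sum_nonneg fun l _ => mul_nonneg (hw J l) (Real.rpow_nonneg (hb l) _)
    have hA : 0 ≤ ∑ l ∈ Finset.range N, q ^ ((J - l) + (l - J)) :=
      Finset.sum_nonneg fun l _ => hw J l
    have h := Real.inner_le_weight_mul_Lp_of_nonneg (Finset.range N) hP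
      (fun l => q ^ ((J - l) + (l - J))) b (hw J) hb
    have h' := Real.rpow_le_rpow (Finset.sum_nonneg fun l _ => mul_nonneg (hw J l) (hb l)) h
      (by linarith : 0 ≤ P)
    refine h'.trans ?_
    rw [Real.mul_rpow (Real.rpow_nonneg hA _) (Real.rpow_nonneg hB _), ← Real.rpow_mul hA,
      ← Real.rpow_mul hB, inv_mul_cancel₀ (by linarith), Real.rpow_one,
      show (1 - P⁻¹) * P = P - 1 by field_simp]
    gcongr
    exact sum_pow_dist_le hq0 hq1 N J
  calc _ ≤ ∑ J ∈ Finset.range N,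
        K ^ (P - 1) * ∑ l ∈ Finset.range N, q ^ ((J - l) + (l - J)) * b l ^ P :=
        Finset.sum_le_sum fun J _ => hrow J
    _ = K ^ (P - 1) * ∑ l ∈ Finset.range N,
        (∑ J ∈ Finset.range N, q ^ ((l - J) + (J - l))) * b l ^ P := by
        rw [← Finset.mul_sum, Finset.sum_comm]
        simp_rw [Finset.sum_mul, add_comm]
    _ ≤ K ^ (P - 1) * ∑ l ∈ Finset.range N, K * b l ^ P := by
        gcongr with l _
        · exact Real.rpow_nonneg (hb l) _
        · exact sum_pow_dist_le hq0 hq1 N l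
    _ = _ := by
        rw [← Finset.mul_sum, ← mul_assoc, Real.rpow_sub_one hK0.ne', div_mul_cancel₀ _ hK0.ne']

/-- The one-dimensional character `x ↦ e^{2π i n x}`. -/
def echar (n : ℤ) (x : ℝ) : ℂ :=
  Complex.exp (((2 * Real.pi * ((n : ℝ) * x) : ℝ) : ℂ) * Complex.I)

lemma continuous_echar (n : ℤ) : Continuous (echar n) := by
  unfold echar; fun_prop

lemma norm_echar (n : ℤ) (x : ℝ) : ‖echar n x‖ = 1 := Complex.norm_exp_ofReal_mul_I _

lemma conj_echar_mul_echar (m n : ℤ) (x : ℝ) :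
    (starRingEnd ℂ) (echar m x) * echar n x = echar (n - m) x := by
  unfold echar
  rw [← Complex.exp_conj, ← Complex.exp_add]
  congr 1
  simp only [map_mul, Complex.conj_ofReal, Complex.conj_I]
  push_cast
  ring

lemma integral_echar (n : ℤ) :
    ∫ x in Set.Ico (0:ℝ) 1, echar n x = if n = 0 then 1 else 0 := by
  rw [integral_Ico_eq_integral_Ioc, ← intervalIntegral.integral_of_le zero_le_one]
  split_ifs with h
  · simp [h, echar]
  · have hne : (2 * Real.pi * n * Complex.I : ℂ) ≠ 0 := by
      simp [Real.pi_ne_zero, h]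
    have hrw : ∀ x : ℝ, echar n x = Complex.exp ((2 * Real.pi * n * Complex.I) * x) := by
      intro x; unfold echar; congr 1; push_cast; ring
    simp_rw [hrw]
    rw [integral_exp_mul_complex hne]
    have : Complex.exp (2 * Real.pi * n * Complex.I) = 1 := by
      rw [← Complex.exp_int_mul_two_pi_mul_I n]; congr 1; ring
    simp [this]

section HilbertValued

variable {H : Type*} [NormedAddCommGroup H] [InnerProductSpace ℂ H]

lemma continuous_sum_echar (S : Finset ℤ) (c : ℤ → H) :
    Continuous fun x : ℝ => ∑ k ∈ S, echar k x • c k :=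
  continuous_finsetSum _ fun k _ => (continuous_echar k).smul continuous_const

lemma integrableOn_Ico_of_continuous {E : Type*} [NormedAddCommGroup E] {g : ℝ → E}
    (hg : Continuous g) : IntegrableOn g (Set.Ico 0 1) :=
  (hg.integrableOn_Icc (a := 0) (b := 1)).mono_set Set.Ico_subset_Icc_self

/-- Parseval's identity for Hilbert-valued trigonometric polynomials. -/
lemma integral_norm_sq_sum_echar (S : Finset ℤ) (c : ℤ → H) :
    ∫ x in Set.Ico (0:ℝ) 1, ‖∑ k ∈ S, echar k x • c k‖ ^ 2 = ∑ k ∈ S, ‖c k‖ ^ 2 := by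
  have h : ∀ x : ℝ, ((‖∑ k ∈ S, echar k x • c k‖ ^ 2 : ℝ) : ℂ) =
      ∑ k ∈ S, ∑ l ∈ S, echar (l - k) x * inner ℂ (c k) (c l) := by
    intro x
    rw [Complex.ofReal_pow]
    refine (inner_self_eq_norm_sq_to_K (𝕜 := ℂ) (∑ k ∈ S, echar k x • c k)).symm.trans ?_
    rw [sum_inner]
    refine Finset.sum_congr rfl fun k _ => ?_
    rw [inner_sum]
    refine Finset.sum_congr rfl fun l _ => ?_
    rw [inner_smul_left, inner_smul_right, ← conj_echar_mul_echar]
    ring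
  have hint : ∀ k l, IntegrableOn (fun x => echar (l - k) x * inner ℂ (c k) (c l))
      (Set.Ico (0:ℝ) 1) := fun k l =>
    integrableOn_Ico_of_continuous ((continuous_echar _).mul continuous_const)
  apply Complex.ofReal_injective
  rw [← integral_complex_ofReal]
  simp_rw [h]
  rw [integral_finsetSum _ fun k _ => integrable_finsetSum _ fun l _ => hint k l, Complex.ofReal_sum]
  refine Finset.sum_congr rfl fun k hk => ?_
  rw [integral_finsetSum _ fun l _ => hint k l]
  simp_rw [integral_mul_const, integral_echar]
  rw [Finset.sum_eq_single k]
  · simp [inner_self_eq_norm_sq_to_K]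
  · intro l _ hl
    simp [sub_eq_zero, hl]
  · exact fun h => absurd hk h

/-- The frequencies of `S` in the `l`-th dyadic block. -/
def dyadicPart (S : Finset ℤ) (l : ℕ) : Finset ℤ := S.filter fun k => k.natAbs.size = l

lemma card_dyadicPart_le (S : Finset ℤ) (l : ℕ) : (dyadicPart S l).card ≤ 2 ^ (l + 1) := by
  have hsub : dyadicPart S l ⊆ Finset.Ico (-(2 ^ l : ℤ)) (2 ^ l) := by
    intro k hk
    have h1 : k.natAbs < 2 ^ l := by
      rw [← Nat.size_le, (Finset.mem_filter.1 hk).2]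
    have h2 : (k.natAbs : ℤ) < 2 ^ l := by exact_mod_cast h1
    rw [Finset.mem_Ico]
    omega
  refine (Finset.card_le_card hsub).trans ?_
  rw [Int.card_Ico, pow_succ]
  have : ((2:ℤ) ^ l - -2 ^ l) = ((2 ^ l * 2 : ℕ) : ℤ) := by push_cast; ring
  rw [this, Int.toNat_natCast]

lemma two_pow_size_le (k : ℤ) : (2:ℝ) ^ k.natAbs.size ≤ 2 * (1 + |(k:ℝ)|) := by
  have habs : |(k:ℝ)| = k.natAbs := by rw [Nat.cast_natAbs, Int.cast_abs]
  rw [habs]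
  rcases h : k.natAbs.size with _ | m
  · have : (0:ℝ) ≤ k.natAbs := Nat.cast_nonneg _
    simp; linarith
  · have h1 : 2 ^ m ≤ k.natAbs := Nat.lt_size.1 (by omega)
    have h2 : (2:ℝ) ^ m ≤ k.natAbs := by exact_mod_cast h1
    rw [pow_succ]; linarith

lemma sum_tail_mul_rpow_le {P : ℝ} (hP : 2 < P) {q : ℝ} (hq1 : q < 1)
    (hqa : (2:ℝ) ^ (-(1 / 2 - 1 / P)) ≤ q) (hqb : (2:ℝ) ^ (-(1 / P)) ≤ q) (N : ℕ)
    (b u v : ℕ → ℝ) (hb : ∀ l, 0 ≤ b l) (hu0 : ∀ l, 0 ≤ u l)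
    (hu : ∀ l, u l ≤ 2 * (2 ^ (1 / P)) ^ l * b l)
    (hv : ∀ l, v l ≤ (2 * (2 ^ (-(1 / 2 - 1 / P))) ^ l * b l) ^ 2) :
    ∑ J ∈ Finset.range N, (∑ l ∈ Finset.Ico J N, v l) *
        (∑ l ∈ Finset.range (J + 1), u l) ^ (P - 2) ≤
      2 ^ P * ((2 / (1 - q)) ^ P * ∑ l ∈ Finset.range N, b l ^ P) := by
  set ρ : ℝ := 2 ^ (-(1 / 2 - 1 / P)) with hρ
  set σ : ℝ := 2 ^ (1 / P) with hσ
  have hρ0 : 0 < ρ := by positivity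
  have hσ0 : 0 < σ := by positivity
  have hq0 : 0 < q := hρ0.trans_le hqa
  have hσq : σ⁻¹ ≤ q := by rw [hσ, ← Real.rpow_neg two_pos.le]; exact hqb
  set D : ℕ → ℝ := fun J => ∑ l ∈ Finset.range N, q ^ ((J - l) + (l - J)) * b l with hD
  have hD0 : ∀ J, 0 ≤ D J := fun J =>
    Finset.sum_nonneg fun l _ => mul_nonneg (by positivity) (hb l)
  have hprod : ∀ J : ℕ, (ρ ^ J) ^ 2 * (σ ^ J) ^ (P - 2) = 1 := by
    intro J
    rw [hρ, hσ, ← Real.rpow_natCast, ← Real.rpow_natCast, ← Real.rpow_natCast,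
      ← Real.rpow_mul two_pos.le, ← Real.rpow_mul two_pos.le, ← Real.rpow_mul two_pos.le,
      ← Real.rpow_mul two_pos.le, ← Real.rpow_add two_pos]
    have : -(1 / 2 - 1 / P) * (J:ℝ) * ((2:ℕ):ℝ) + 1 / P * J * (P - 2) = 0 := by
      push_cast
      field_simp
      ring
    rw [this, Real.rpow_zero]
  have hterm : ∀ J ∈ Finset.range N, (∑ l ∈ Finset.Ico J N, v l) *
      (∑ l ∈ Finset.range (J + 1), u l) ^ (P - 2) ≤ 2 ^ P * D J ^ P := by
    intro J hJ
    have hJN := Finset.mem_range.1 hJ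
    have hV : ∑ l ∈ Finset.Ico J N, v l ≤ (2 * ρ ^ J * D J) ^ 2 := by
      have h1 : ∑ l ∈ Finset.Ico J N, v l ≤ (∑ l ∈ Finset.Ico J N, 2 * ρ ^ l * b l) ^ 2 :=
        (Finset.sum_le_sum fun l _ => hv l).trans
          (Finset.sum_sq_le_sq_sum_of_nonneg fun l _ =>
            mul_nonneg (by positivity) (hb l))
      refine h1.trans ?_
      have h2 : ∑ l ∈ Finset.Ico J N, 2 * ρ ^ l * b l ≤ 2 * ρ ^ J * D J := by
        rw [hD, Finset.mul_sum]
        refine (Finset.sum_le_sum fun l hl => ?_).trans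
          (Finset.sum_le_sum_of_subset_of_nonneg (s := Finset.Ico J N)
            (fun l hl => Finset.mem_range.2 (Finset.mem_Ico.1 hl).2)
            fun l _ _ => mul_nonneg (by positivity) (mul_nonneg (by positivity) (hb l)))
        have hJl := (Finset.mem_Ico.1 hl).1
        rw [← mul_assoc]
        refine mul_le_mul_of_nonneg_right ?_ (hb l)
        rw [mul_assoc]
        refine mul_le_mul_of_nonneg_left ?_ two_pos.le
        rw [show (J - l) + (l - J) = l - J by omega]
        calc ρ ^ l = ρ ^ J * ρ ^ (l - J) := by rw [← pow_add]; congr 1; omega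
          _ ≤ _ := by gcongr
      refine pow_le_pow_left₀ (Finset.sum_nonneg fun l _ =>
            mul_nonneg (by positivity) (hb l)) h2 2
    have hU : ∑ l ∈ Finset.range (J + 1), u l ≤ 2 * σ ^ J * D J := by
      rw [hD, Finset.mul_sum]
      refine (Finset.sum_le_sum fun l hl => ?_).trans
        (Finset.sum_le_sum_of_subset_of_nonneg (s := Finset.range (J + 1))
          (fun l hl => Finset.mem_range.2 (by have := Finset.mem_range.1 hl; omega))
          fun l _ _ => mul_nonneg (by positivity) (mul_nonneg (by positivity) (hb l)))
      have hJl := Finset.mem_range.1 hl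
      refine (hu l).trans ?_
      rw [← mul_assoc]
      refine mul_le_mul_of_nonneg_right ?_ (hb l)
      rw [mul_assoc]
      refine mul_le_mul_of_nonneg_left ?_ two_pos.le
      rw [show (J - l) + (l - J) = J - l by omega]
      calc σ ^ l = σ ^ J * σ⁻¹ ^ (J - l) := by
            rw [inv_pow, ← div_eq_mul_inv, _root_.eq_div_iff (by positivity), ← pow_add]
            congr 1; omega
        _ ≤ _ := by gcongr
    have hU0 : 0 ≤ ∑ l ∈ Finset.range (J + 1), u l := Finset.sum_nonneg fun l _ => hu0 l
    calc _ ≤ (2 * ρ ^ J * D J) ^ 2 * (2 * σ ^ J * D J) ^ (P - 2) := by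
          gcongr
      _ = ((ρ ^ J) ^ 2 * (σ ^ J) ^ (P - 2)) * ((2:ℝ) ^ (2:ℝ) * 2 ^ (P - 2)) *
          (D J ^ (2:ℝ) * D J ^ (P - 2)) := by
          rw [Real.mul_rpow (mul_nonneg two_pos.le (by positivity)) (hD0 J),
            Real.mul_rpow two_pos.le (by positivity)]
          norm_num only [Real.rpow_two]
          ring
      _ = _ := by
          rw [hprod, one_mul, ← Real.rpow_add two_pos, ← Real.rpow_add_of_nonneg (hD0 J) two_pos.le
            (by linarith), add_sub_cancel]
  refine (Finset.sum_le_sum hterm).trans ?_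
  rw [← Finset.mul_sum]
  gcongr
  exact sum_rpow_geometric_conv_le hq0 hq1 (by linarith) N b hb

lemma sum_rpow_le_card {ι : Type*} (T : Finset ι) (f : ι → ℝ) (hf : ∀ i, 0 ≤ f i) {P : ℝ}
    (hP : 1 ≤ P) {M : ℝ} (hM : (T.card : ℝ) ≤ M) :
    (∑ i ∈ T, f i) ^ P ≤ M ^ (P - 1) * ∑ i ∈ T, f i ^ P := by
  refine (Real.rpow_sum_le_const_mul_sum_rpow_of_nonneg _ hP fun i _ => hf i).trans ?_
  gcongr
  exact Finset.sum_nonneg fun i _ => Real.rpow_nonneg (hf i) _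

/-- The one-dimensional Hardy–Littlewood inequality for Hilbert-valued trigonometric
polynomials, exponent `P > 2`. -/
lemma integral_norm_rpow_sum_echar_le_of_two_lt {P : ℝ} (hP : 2 < P) {q : ℝ} (hq1 : q < 1)
    (hqa : (2:ℝ) ^ (-(1 / 2 - 1 / P)) ≤ q) (hqb : (2:ℝ) ^ (-(1 / P)) ≤ q)
    (S : Finset ℤ) (c : ℤ → H) :
    ∫ x in Set.Ico (0:ℝ) 1, ‖∑ k ∈ S, echar k x • c k‖ ^ P ≤
      2 ^ P * (2 ^ P * ((2 / (1 - q)) ^ P * 2 ^ (P - 2))) *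
        ∑ k ∈ S, (1 + |(k:ℝ)|) ^ (P - 2) * ‖c k‖ ^ P := by
  obtain ⟨N, hN⟩ : ∃ N, ∀ k ∈ S, k.natAbs.size < N := by
    refine ⟨S.sup (fun k => k.natAbs.size) + 1, fun k hk => Nat.lt_succ_of_le ?_⟩
    exact Finset.le_sup (f := fun k : ℤ => k.natAbs.size) hk
  have hmaps : ∀ k ∈ S, k.natAbs.size ∈ Finset.range N := fun k hk =>
    Finset.mem_range.2 (hN k hk)
  set F : ℝ → ℕ → H := fun x l => ∑ k ∈ dyadicPart S l, echar k x • c k with hF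
  have hsum : ∀ x, ∑ k ∈ S, echar k x • c k = ∑ l ∈ Finset.range N, F x l := fun x =>
    (Finset.sum_fiberwise_of_maps_to hmaps _).symm
  set u : ℕ → ℝ := fun l => ∑ k ∈ dyadicPart S l, ‖c k‖ with hu
  set v : ℕ → ℝ := fun l => ∑ k ∈ dyadicPart S l, ‖c k‖ ^ 2 with hv
  set β : ℕ → ℝ := fun l => ∑ k ∈ dyadicPart S l, ‖c k‖ ^ P with hβ
  have hβ0 : ∀ l, 0 ≤ β l := fun l =>
    Finset.sum_nonneg fun k _ => Real.rpow_nonneg (norm_nonneg _) _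
  have hu0 : ∀ l, 0 ≤ u l := fun l => Finset.sum_nonneg fun k _ => norm_nonneg _
  have hv0 : ∀ l, 0 ≤ v l := fun l => Finset.sum_nonneg fun k _ => sq_nonneg _
  have hFu : ∀ x l, ‖F x l‖ ≤ u l := fun x l =>
    (norm_sum_le _ _).trans (Finset.sum_le_sum fun k _ => by rw [norm_smul, norm_echar, one_mul])
  have htail : ∀ x J, ∑ l ∈ Finset.Ico J N, F x l =
      ∑ k ∈ S.filter (fun k => k.natAbs.size ∈ Finset.Ico J N), echar k x • c k := by
    intro x J
    rw [hF, ← Finset.sum_fiberwise_of_maps_to (t := Finset.Ico J N)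
      (g := fun k : ℤ => k.natAbs.size) fun k hk => (Finset.mem_filter.1 hk).2]
    refine Finset.sum_congr rfl fun l hl => Finset.sum_congr ?_ fun _ _ => rfl
    ext k
    simp only [dyadicPart, Finset.mem_filter]
    exact ⟨fun h => ⟨⟨h.1, h.2 ▸ hl⟩, h.2⟩, fun h => ⟨h.1.1, h.2⟩⟩
  have htailv : ∀ J, ∑ l ∈ Finset.Ico J N, v l =
      ∑ k ∈ S.filter (fun k => k.natAbs.size ∈ Finset.Ico J N), ‖c k‖ ^ 2 := by
    intro J
    rw [hv, ← Finset.sum_fiberwise_of_maps_to (t := Finset.Ico J N)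
      (g := fun k : ℤ => k.natAbs.size) fun k hk => (Finset.mem_filter.1 hk).2]
    refine Finset.sum_congr rfl fun l hl => Finset.sum_congr ?_ fun _ _ => rfl
    ext k
    simp only [dyadicPart, Finset.mem_filter]
    exact ⟨fun h => ⟨⟨h.1, h.2 ▸ hl⟩, h.2⟩, fun h => ⟨h.1.1, h.2⟩⟩
  have hint : ∀ J, IntegrableOn (fun x => ‖∑ l ∈ Finset.Ico J N, F x l‖ ^ 2 *
      (∑ l ∈ Finset.range (J + 1), u l) ^ (P - 2)) (Set.Ico (0:ℝ) 1) := by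
    intro J
    simp_rw [htail]
    exact integrableOn_Ico_of_continuous
      (((continuous_sum_echar _ c).norm.pow 2).mul continuous_const)
  have hstep : ∫ x in Set.Ico (0:ℝ) 1, ‖∑ k ∈ S, echar k x • c k‖ ^ P ≤
      2 ^ P * ∑ J ∈ Finset.range N, (∑ l ∈ Finset.Ico J N, v l) *
        (∑ l ∈ Finset.range (J + 1), u l) ^ (P - 2) := by
    calc _ ≤ ∫ x in Set.Ico (0:ℝ) 1, 2 ^ P * ∑ J ∈ Finset.range N,
          ‖∑ l ∈ Finset.Ico J N, F x l‖ ^ 2 * (∑ l ∈ Finset.range (J + 1), u l) ^ (P - 2) := by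
          refine integral_mono ?_ ?_ fun x => ?_
          · exact integrableOn_Ico_of_continuous ((continuous_sum_echar S c).norm.rpow_const
              fun _ => Or.inr (by linarith))
          · exact (integrable_finsetSum _ fun J _ => hint J).const_mul _
          · simp only [hsum]
            exact norm_sum_rpow_le_tail N (F x) u (hFu x) hP
      _ = _ := by
          rw [integral_const_mul, integral_finsetSum _ fun J _ => hint J]
          congr 1
          refine Finset.sum_congr rfl fun J _ => ?_
          rw [integral_mul_const, htailv]
          simp_rw [htail]
          rw [integral_norm_sq_sum_echar]
  set b : ℕ → ℝ := fun l => (((2:ℝ) ^ l) ^ (P - 2) * β l) ^ P⁻¹ with hb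
  have hP0 : P ≠ 0 := by linarith
  have hbarg : ∀ l, 0 ≤ ((2:ℝ) ^ l) ^ (P - 2) * β l := fun l =>
    mul_nonneg (by positivity) (hβ0 l)
  have hb0 : ∀ l, 0 ≤ b l := fun l => Real.rpow_nonneg (hbarg l) _
  have hbP : ∀ l, b l ^ P = ((2:ℝ) ^ l) ^ (P - 2) * β l := fun l => by
    rw [hb, ← Real.rpow_mul (hbarg l), inv_mul_cancel₀ hP0, Real.rpow_one]
  have hcard : ∀ l, ((dyadicPart S l).card : ℝ) ≤ 2 ^ (l + 1) := fun l => by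
    exact_mod_cast card_dyadicPart_le S l
  have hub : ∀ l, u l ≤ 2 * (2 ^ (1 / P)) ^ l * b l := by
    intro l
    rw [← Real.rpow_le_rpow_iff (hu0 l) (mul_nonneg (by positivity) (hb0 l))
      (by linarith : 0 < P), Real.mul_rpow (by positivity) (hb0 l), hbP]
    refine (sum_rpow_le_card _ _ (fun k => norm_nonneg (c k)) (by linarith) (hcard l)).trans ?_
    rw [← mul_assoc]
    refine mul_le_mul_of_nonneg_right ?_ (hβ0 l)
    rw [← Real.rpow_natCast, ← Real.rpow_natCast, ← Real.rpow_natCast,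
      Real.mul_rpow (by positivity) (by positivity), ← Real.rpow_mul two_pos.le,
      ← Real.rpow_mul two_pos.le, ← Real.rpow_mul two_pos.le, ← Real.rpow_mul two_pos.le,
      ← Real.rpow_add two_pos, ← Real.rpow_add two_pos]
    refine Real.rpow_le_rpow_of_exponent_le one_le_two ?_
    have : 1 / P * l * P = l := by field_simp
    rw [this]
    push_cast
    linarith
  have hvb : ∀ l, v l ≤ (2 * (2 ^ (-(1 / 2 - 1 / P))) ^ l * b l) ^ 2 := by
    intro l
    have hR : (0:ℝ) ≤ 2 * (2 ^ (-(1 / 2 - 1 / P))) ^ l * b l := mul_nonneg (by positivity) (hb0 l)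
    rw [← Real.rpow_le_rpow_iff (hv0 l) (by positivity) (by linarith : 0 < P / 2),
      ← Real.rpow_natCast _ 2, ← Real.rpow_mul hR,
      show ((2:ℕ):ℝ) * (P / 2) = P by push_cast; ring, Real.mul_rpow (by positivity) (hb0 l), hbP]
    refine (sum_rpow_le_card _ _ (fun k => sq_nonneg ‖c k‖) (by linarith) (hcard l)).trans ?_
    have hβ' : ∑ k ∈ dyadicPart S l, (‖c k‖ ^ 2) ^ (P / 2) = β l :=
      Finset.sum_congr rfl fun k _ => by
        rw [← Real.rpow_natCast, ← Real.rpow_mul (norm_nonneg _)]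
        congr 1; push_cast; ring
    rw [hβ', ← mul_assoc]
    refine mul_le_mul_of_nonneg_right ?_ (hβ0 l)
    rw [← Real.rpow_natCast, ← Real.rpow_natCast, ← Real.rpow_natCast,
      Real.mul_rpow (by positivity) (by positivity), ← Real.rpow_mul two_pos.le,
      ← Real.rpow_mul two_pos.le, ← Real.rpow_mul two_pos.le, ← Real.rpow_mul two_pos.le,
      ← Real.rpow_add two_pos, ← Real.rpow_add two_pos]
    refine Real.rpow_le_rpow_of_exponent_le one_le_two ?_
    have : -(1 / 2 - 1 / P) * l * P = l - l * P / 2 := by field_simp; ring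
    rw [this]
    push_cast
    linarith
  have hbsum : ∑ l ∈ Finset.range N, b l ^ P ≤
      2 ^ (P - 2) * ∑ k ∈ S, (1 + |(k:ℝ)|) ^ (P - 2) * ‖c k‖ ^ P := by
    rw [← Finset.sum_fiberwise_of_maps_to hmaps, Finset.mul_sum]
    refine Finset.sum_le_sum fun l _ => ?_
    rw [hbP, hβ, Finset.mul_sum, Finset.mul_sum]
    refine Finset.sum_le_sum fun k hk => ?_
    rw [← mul_assoc, ← Real.mul_rpow two_pos.le (by positivity)]
    refine mul_le_mul_of_nonneg_right ?_ (Real.rpow_nonneg (norm_nonneg _) _)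
    rw [← (Finset.mem_filter.1 hk).2]
    exact Real.rpow_le_rpow (by positivity) (two_pow_size_le k) (by linarith)
  refine hstep.trans ?_
  rw [mul_assoc]
  refine mul_le_mul_of_nonneg_left ?_ (by positivity)
  refine (sum_tail_mul_rpow_le hP hq1 hqa hqb N b u v hb0 hu0 hub hvb).trans ?_
  rw [mul_assoc, mul_assoc]
  have : 0 ≤ 2 / (1 - q) := div_nonneg two_pos.le (by linarith)
  gcongr

end HilbertValued

/-- The one-dimensional Hardy–Littlewood inequality for Hilbert-valued trigonometric
polynomials. -/
lemma exists_lintegral_enorm_rpow_sum_echar_le {P : ℝ} (hP : 2 ≤ P) :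
    ∃ C : ℝ≥0∞, C ≠ ∞ ∧ ∀ (H : Type) [NormedAddCommGroup H] [InnerProductSpace ℂ H]
      (S : Finset ℤ) (c : ℤ → H),
      ∫⁻ x in Set.Ico (0:ℝ) 1, ‖∑ k ∈ S, echar k x • c k‖ₑ ^ P ≤
        C * ∑ k ∈ S, ENNReal.ofReal ((1 + |(k:ℝ)|) ^ (P - 2)) * ‖c k‖ₑ ^ P := by
  obtain ⟨C, hC0, hC⟩ : ∃ C : ℝ, 0 ≤ C ∧ ∀ (H : Type) [NormedAddCommGroup H]
      [InnerProductSpace ℂ H] (S : Finset ℤ) (c : ℤ → H),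
      ∫ x in Set.Ico (0:ℝ) 1, ‖∑ k ∈ S, echar k x • c k‖ ^ P ≤
        C * ∑ k ∈ S, (1 + |(k:ℝ)|) ^ (P - 2) * ‖c k‖ ^ P := by
    rcases hP.eq_or_lt with rfl | hP
    · refine ⟨1, zero_le_one, fun H _ _ S c => ?_⟩
      simp [integral_norm_sq_sum_echar]
    · have h1 : (2:ℝ) ^ (-(1 / 2 - 1 / P)) < 1 := by
        refine Real.rpow_lt_one_of_one_lt_of_neg one_lt_two ?_
        have : 1 / P < 1 / 2 := one_div_lt_one_div_of_lt two_pos hP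
        linarith
      have h2 : (2:ℝ) ^ (-(1 / P)) < 1 :=
        Real.rpow_lt_one_of_one_lt_of_neg one_lt_two (neg_lt_zero.2 (by positivity))
      refine ⟨_, ?_, fun H _ _ S c => integral_norm_rpow_sum_echar_le_of_two_lt hP
        (max_lt h1 h2) (le_max_left _ _) (le_max_right _ _) S c⟩
      have : 0 < 1 - max ((2:ℝ) ^ (-(1 / 2 - 1 / P))) (2 ^ (-(1 / P))) :=
        sub_pos.2 (max_lt h1 h2)
      positivity
  refine ⟨ENNReal.ofReal C, ENNReal.ofReal_ne_top, fun H _ _ S c => ?_⟩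
  have hP0 : 0 ≤ P := by linarith
  have hint : IntegrableOn (fun x => ‖∑ k ∈ S, echar k x • c k‖ ^ P) (Set.Ico (0:ℝ) 1) :=
    integrableOn_Ico_of_continuous ((continuous_sum_echar S c).norm.rpow_const
      fun _ => Or.inr hP0)
  have henorm : ∀ v : H, ‖v‖ₑ ^ P = ENNReal.ofReal (‖v‖ ^ P) := fun v => by
    rw [← ofReal_norm, ENNReal.ofReal_rpow_of_nonneg (norm_nonneg _) hP0]
  simp_rw [henorm]
  rw [← ofReal_integral_eq_lintegral_ofReal hint
    (Filter.Eventually.of_forall fun x => Real.rpow_nonneg (norm_nonneg _) _)]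
  refine (ENNReal.ofReal_le_ofReal (hC H S c)).trans_eq ?_
  rw [ENNReal.ofReal_mul hC0, ENNReal.ofReal_sum_of_nonneg fun k _ => by positivity]
  congr 1
  exact Finset.sum_congr rfl fun k _ => ENNReal.ofReal_mul (by positivity)

lemma continuous_expk (d : ℕ) (k : Fin d → ℤ) : Continuous (expk d k) := by
  unfold expk; fun_prop

lemma norm_expk (d : ℕ) (k : Fin d → ℤ) (x : Fin d → ℝ) : ‖expk d k x‖ = 1 :=
  Complex.norm_exp_ofReal_mul_I _

lemma expk_cons (d : ℕ) (n : ℤ) (k : Fin d → ℤ) (t : ℝ) (x : Fin d → ℝ) :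
    expk (d + 1) (Fin.cons n k) (Fin.cons t x) = echar n t * expk d k x := by
  unfold expk echar
  rw [← Complex.exp_add, Fin.sum_univ_succ]
  congr 1
  simp only [Fin.cons_zero, Fin.cons_succ]
  push_cast
  ring

lemma wt_cons (d : ℕ) (n : ℤ) (k : Fin d → ℤ) :
    wt (d + 1) (Fin.cons n k) = (1 + |(n:ℝ)|) * wt d k := by
  simp [wt, Fin.prod_univ_succ]

lemma one_le_wt (d : ℕ) (k : Fin d → ℤ) : 1 ≤ wt d k :=
  Finset.prod_induction _ (1 ≤ ·) (fun _ _ => one_le_mul_of_one_le_of_one_le) le_rfl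
    fun i _ => by linarith [abs_nonneg (k i : ℝ)]

lemma wt_pos (d : ℕ) (k : Fin d → ℤ) : 0 < wt d k := zero_lt_one.trans_le (one_le_wt d k)

lemma sum_piFinset_succ {M : Type*} [AddCommMonoid M] (d : ℕ) (T : Finset ℤ)
    (φ : (Fin (d + 1) → ℤ) → M) :
    ∑ k ∈ Fintype.piFinset (fun _ : Fin (d + 1) => T), φ k =
      ∑ n ∈ T, ∑ k ∈ Fintype.piFinset (fun _ : Fin d => T), φ (Fin.cons n k) := by
  rw [← Finset.sum_product']
  refine Finset.sum_nbij' (fun k => (k 0, Fin.tail k)) (fun a => Fin.cons a.1 a.2) ?_ ?_ ?_ ?_ ?_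
  · intro k hk
    rw [Fintype.mem_piFinset] at hk
    exact Finset.mem_product.2 ⟨hk 0, Fintype.mem_piFinset.2 fun i => hk i.succ⟩
  · intro a ha
    rw [Finset.mem_product, Fintype.mem_piFinset] at ha
    rw [Fintype.mem_piFinset]
    exact fun i => Fin.cases ha.1 ha.2 i
  · intro k _; simp
  · intro a _; simp
  · intro k _; simp

lemma restrict_cube (d : ℕ) : (volume : Measure (Fin d → ℝ)).restrict (cube d) =
    Measure.pi fun _ => (volume : Measure ℝ).restrict (Set.Ico 0 1) := by
  rw [cube, volume_pi, Measure.restrict_pi_pi]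

lemma lintegral_cube_succ (d : ℕ) (G : (Fin (d + 1) → ℝ) → ℝ≥0∞) (hG : Measurable G) :
    ∫⁻ x in cube (d + 1), G x =
      ∫⁻ x in cube d, ∫⁻ t in Set.Ico (0:ℝ) 1, G (Fin.cons t x) := by
  have hmp := (measurePreserving_piFinSuccAbove
    (fun _ : Fin (d + 1) => (volume : Measure ℝ).restrict (Set.Ico 0 1)) 0).symm
  rw [restrict_cube, restrict_cube, ← hmp.lintegral_comp hG]
  refine (lintegral_prod_symm _ (hG.comp (MeasurableEquiv.measurable _)).aemeasurable).trans ?_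
  refine lintegral_congr fun x => lintegral_congr fun t => ?_
  simp only [Function.comp_apply, MeasurableEquiv.piFinSuccAbove, Fin.insertNthEquiv_zero]
  rfl

lemma continuous_sum_expk {H : Type*} [NormedAddCommGroup H] [NormedSpace ℂ H] (d : ℕ)
    (S : Finset (Fin d → ℤ)) (c : (Fin d → ℤ) → H) :
    Continuous fun x => ∑ k ∈ S, expk d k x • c k :=
  continuous_finsetSum _ fun k _ => (continuous_expk d k).smul continuous_const

lemma measurable_enorm_rpow_sum_expk {H : Type*} [NormedAddCommGroup H] [NormedSpace ℂ H]
    (d : ℕ) (S : Finset (Fin d → ℤ)) (c : (Fin d → ℤ) → H) (P : ℝ) :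
    Measurable fun x => ‖∑ k ∈ S, expk d k x • c k‖ₑ ^ P :=
  (continuous_sum_expk d S c).enorm.measurable.pow_const P

/-- The Hardy–Littlewood inequality for Hilbert-valued trigonometric polynomials in `d`
variables. -/
lemma exists_lintegral_enorm_rpow_sum_expk_le (d : ℕ) {P : ℝ} (hP : 2 ≤ P) :
    ∃ C : ℝ≥0∞, C ≠ ∞ ∧ ∀ (H : Type) [NormedAddCommGroup H] [InnerProductSpace ℂ H]
      (T : Finset ℤ) (c : (Fin d → ℤ) → H),
      ∫⁻ x in cube d, ‖∑ k ∈ Fintype.piFinset (fun _ : Fin d => T), expk d k x • c k‖ₑ ^ P ≤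
        C * ∑ k ∈ Fintype.piFinset (fun _ : Fin d => T),
          ENNReal.ofReal (wt d k ^ (P - 2)) * ‖c k‖ₑ ^ P := by
  obtain ⟨C₁, hC₁, h₁⟩ := exists_lintegral_enorm_rpow_sum_echar_le hP
  induction d with
  | zero =>
    refine ⟨1, ENNReal.one_ne_top, fun H _ _ T c => ?_⟩
    simp [wt, expk, cube, Fintype.piFinset_of_isEmpty, volume_pi]
  | succ d ih =>
    obtain ⟨C, hC, h⟩ := ih
    refine ⟨C₁ * C, ENNReal.mul_ne_top hC₁ hC, fun H _ _ T c => ?_⟩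
    rw [lintegral_cube_succ _ _ (measurable_enorm_rpow_sum_expk _ _ _ _)]
    set B := Fintype.piFinset (fun _ : Fin d => T)
    have hsum : ∀ (x : Fin d → ℝ) (t : ℝ),
        ∑ k ∈ Fintype.piFinset (fun _ : Fin (d + 1) => T), expk (d + 1) k (Fin.cons t x) • c k =
          ∑ n ∈ T, echar n t • ∑ k ∈ B, expk d k x • c (Fin.cons n k) := by
      intro x t
      rw [sum_piFinset_succ]
      simp_rw [expk_cons, Finset.smul_sum, mul_smul]
      rfl
    simp_rw [hsum]
    have hm : ∀ n : ℤ, Measurable fun x : Fin d → ℝ =>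
        ‖∑ k ∈ B, expk d k x • c (Fin.cons n k)‖ₑ ^ P := fun n =>
      measurable_enorm_rpow_sum_expk d B (fun k => c (Fin.cons n k)) P
    calc _ ≤ ∫⁻ x in cube d, C₁ * ∑ n ∈ T, ENNReal.ofReal ((1 + |(n:ℝ)|) ^ (P - 2)) *
            ‖∑ k ∈ B, expk d k x • c (Fin.cons n k)‖ₑ ^ P :=
          lintegral_mono fun x => h₁ H T fun n => ∑ k ∈ B, expk d k x • c (Fin.cons n k)
      _ = C₁ * ∑ n ∈ T, ENNReal.ofReal ((1 + |(n:ℝ)|) ^ (P - 2)) *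
            ∫⁻ x in cube d, ‖∑ k ∈ B, expk d k x • c (Fin.cons n k)‖ₑ ^ P := by
          rw [lintegral_const_mul' _ _ hC₁,
            lintegral_finsetSum _ fun n _ => (hm n).const_mul _]
          simp_rw [lintegral_const_mul' _ _ ENNReal.ofReal_ne_top]
      _ ≤ C₁ * ∑ n ∈ T, ENNReal.ofReal ((1 + |(n:ℝ)|) ^ (P - 2)) *
            (C * ∑ k ∈ B, ENNReal.ofReal (wt d k ^ (P - 2)) * ‖c (Fin.cons n k)‖ₑ ^ P) := by
          gcongr with n _
          exact h H T fun k => c (Fin.cons n k)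
      _ = _ := by
          rw [sum_piFinset_succ, mul_assoc, Finset.mul_sum (a := C)]
          congr 1
          refine Finset.sum_congr rfl fun n _ => ?_
          rw [← mul_assoc, mul_comm _ C, mul_assoc, Finset.mul_sum]
          congr 1
          refine Finset.sum_congr rfl fun k _ => ?_
          rw [wt_cons, Real.mul_rpow (by positivity) (wt_pos d k).le,
            ENNReal.ofReal_mul (by positivity), mul_assoc]

lemma eq_size_of_mem_blockF {k : ℤ} {n : ℕ} (h : k ∈ blockF n) : n = k.natAbs.size := by
  rcases (Finset.mem_filter.1 h).2 with ⟨rfl, rfl⟩ | ⟨hn, h1, h2⟩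
  · simp
  · rw [Int.abs_eq_natAbs] at h1 h2
    have h1' : 2 ^ (n - 1) ≤ k.natAbs := by exact_mod_cast h1
    have h2' : k.natAbs < 2 ^ n := by exact_mod_cast h2
    have := Nat.lt_size.2 h1'
    have := Nat.size_le.2 h2'
    omega

lemma blockF_subset_Icc {n N : ℕ} (h : n ≤ N) : blockF n ⊆ Finset.Icc (-(2 ^ N : ℤ)) (2 ^ N) := by
  intro k hk
  have h1 := Finset.mem_Icc.1 (Finset.mem_filter.1 hk).1
  have h2 : (2:ℤ) ^ n ≤ 2 ^ N := pow_le_pow_right₀ (by norm_num) h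
  rw [Finset.mem_Icc]
  omega

lemma two_pow_sum_size_le (d : ℕ) (k : Fin d → ℤ) :
    (2:ℝ) ^ (∑ i, (k i).natAbs.size) ≤ 2 ^ d * wt d k := by
  have hd : (2:ℝ) ^ d = ∏ _i : Fin d, (2:ℝ) := by simp
  rw [← Finset.prod_pow_eq_pow_sum, wt, hd, ← Finset.prod_mul_distrib]
  exact Finset.prod_le_prod (fun i _ => by positivity) fun i _ => two_pow_size_le (k i)

/-- The `θ`-th power of a summand of the Wiener norm absorbs the Hardy–Littlewood weight. -/
lemma ofReal_wt_mul_rpow (d : ℕ) (k : Fin d → ℤ) (r : ℝ) {P : ℝ} (hP : 0 < P) (a : ℝ≥0∞) :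
    ENNReal.ofReal (wt d k ^ (P - 2)) * (ENNReal.ofReal (wt d k ^ r) * a) ^ P =
      (ENNReal.ofReal (wt d k ^ (r + 1 - 2 / P)) * a) ^ P := by
  have hw := wt_pos d k
  rw [ENNReal.mul_rpow_of_nonneg _ _ hP.le, ENNReal.mul_rpow_of_nonneg _ _ hP.le, ← mul_assoc,
    ENNReal.ofReal_rpow_of_nonneg (by positivity) hP.le,
    ENNReal.ofReal_rpow_of_nonneg (by positivity) hP.le, ← ENNReal.ofReal_mul (by positivity),
    ← Real.rpow_mul hw.le, ← Real.rpow_mul hw.le, ← Real.rpow_add hw]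
  congr 4
  field_simp
  ring

lemma enorm_euclideanSpace_sq {ι : Type*} [Fintype ι] (v : EuclideanSpace ℂ ι) :
    ‖v‖ₑ ^ 2 = ∑ i, ‖v i‖ₑ ^ 2 := by
  simp_rw [← ofReal_norm, ← ENNReal.ofReal_pow (norm_nonneg _)]
  rw [EuclideanSpace.norm_sq_eq, ENNReal.ofReal_sum_of_nonneg fun i _ => sq_nonneg _]

lemma lintegral_square_function_le (d : ℕ) {P : ℝ} (hP : 2 ≤ P) {r : ℝ} (hr : 0 ≤ r)
    {C : ℝ≥0∞} (hC : ∀ (H : Type) [NormedAddCommGroup H] [InnerProductSpace ℂ H]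
      (T : Finset ℤ) (c : (Fin d → ℤ) → H),
      ∫⁻ x in cube d, ‖∑ k ∈ Fintype.piFinset (fun _ : Fin d => T), expk d k x • c k‖ₑ ^ P ≤
        C * ∑ k ∈ Fintype.piFinset (fun _ : Fin d => T),
          ENNReal.ofReal (wt d k ^ (P - 2)) * ‖c k‖ₑ ^ P)
    (f : (Fin d → ℝ) → ℂ) (n : ℕ) :
    ∫⁻ x in cube d, ((∑ j ∈ Fintype.piFinset (fun _ : Fin d => Finset.range n),
        (ENNReal.ofReal ((2:ℝ) ^ (((∑ i, j i : ℕ) : ℝ) * r)) * ‖blockProj d f j x‖ₑ) ^ 2)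
          ^ ((1:ℝ) / 2)) ^ P ≤
      C * (ENNReal.ofReal ((2 ^ d) ^ r) ^ P *
        ∑' k, (ENNReal.ofReal (wt d k ^ (r + 1 - 2 / P)) * ‖fCoeff d f k‖ₑ) ^ P) := by
  have hP0 : 0 < P := by linarith
  set J := Fintype.piFinset (fun _ : Fin d => Finset.range n) with hJ
  set T := Finset.Icc (-(2 ^ n : ℤ)) (2 ^ n)
  set B := Fintype.piFinset (fun _ : Fin d => T)
  set w : (Fin d → ℕ) → ℝ := fun j => (2:ℝ) ^ (((∑ i, j i : ℕ) : ℝ) * r) with hw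
  have hw0 : ∀ j, 0 ≤ w j := fun j => by positivity
  classical
  set c : (Fin d → ℤ) → EuclideanSpace ℂ J := fun k => WithLp.toLp 2 fun j =>
    if k ∈ Fintype.piFinset (fun i => blockF (j.1 i)) then (w j.1 : ℂ) * fCoeff d f k else 0 with hc
  have hcoord : ∀ (x : Fin d → ℝ) (j : J),
      (∑ k ∈ B, expk d k x • c k) j = (w j.1 : ℂ) * blockProj d f j.1 x := by
    intro x j
    have hsub : Fintype.piFinset (fun i => blockF (j.1 i)) ⊆ B :=
      Fintype.piFinset_subset _ _ fun i =>
        blockF_subset_Icc (Finset.mem_range.1 (Fintype.mem_piFinset.1 j.2 i)).le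
    simp only [hc, WithLp.ofLp_sum, WithLp.ofLp_smul, Finset.sum_apply, Pi.smul_apply, smul_eq_mul,
      mul_ite, mul_zero]
    rw [← Finset.sum_filter, Finset.filter_mem_eq_inter, Finset.inter_eq_right.2 hsub,
      blockProj, Finset.mul_sum]
    exact Finset.sum_congr rfl fun k _ => by ring
  have hsq : ∀ x : Fin d → ℝ, (∑ j ∈ J, (ENNReal.ofReal (w j) * ‖blockProj d f j x‖ₑ) ^ 2)
      ^ ((1:ℝ) / 2) = ‖∑ k ∈ B, expk d k x • c k‖ₑ := by
    intro x
    have h : ∑ j ∈ J, (ENNReal.ofReal (w j) * ‖blockProj d f j x‖ₑ) ^ 2 =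
        ‖∑ k ∈ B, expk d k x • c k‖ₑ ^ 2 := by
      rw [enorm_euclideanSpace_sq, ← Finset.sum_coe_sort]
      refine Finset.sum_congr rfl fun j _ => ?_
      rw [hcoord, enorm_mul, ← ofReal_norm (w j.1 : ℂ), Complex.norm_real,
        Real.norm_of_nonneg (hw0 j.1)]
    rw [h, ← ENNReal.rpow_natCast, ← ENNReal.rpow_mul]
    norm_num
  have hcnorm : ∀ k, ‖c k‖ₑ ≤ ENNReal.ofReal ((2 ^ d) ^ r) *
      (ENNReal.ofReal (wt d k ^ r) * ‖fCoeff d f k‖ₑ) := by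
    intro k
    set M := ENNReal.ofReal ((2 ^ d) ^ r) * (ENNReal.ofReal (wt d k ^ r) * ‖fCoeff d f k‖ₑ)
    have hterm : ∀ j : J, ‖c k j‖ₑ ^ 2 ≤ if (fun i => (k i).natAbs.size) = j.1 then M ^ 2 else 0 := by
      intro j
      simp only [hc]
      split_ifs with h1 h2 h2
      · gcongr
        rw [enorm_mul, ← ofReal_norm (w j.1 : ℂ), Complex.norm_real, Real.norm_of_nonneg (hw0 j.1)]
        simp only [M]
        rw [← mul_assoc, ← ENNReal.ofReal_mul (by positivity),
          ← Real.mul_rpow (by positivity) (wt_pos d k).le]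
        simp only [hw]
        rw [Real.rpow_mul two_pos.le, Real.rpow_natCast]
        gcongr
        rw [← h2]
        exact two_pow_sum_size_le d k
      · refine absurd (funext fun i => ?_) h2
        exact (eq_size_of_mem_blockF (Fintype.mem_piFinset.1 h1 i)).symm
      · simp
      · simp
    have h2 : ‖c k‖ₑ ^ 2 ≤ M ^ 2 := by
      rw [enorm_euclideanSpace_sq]
      refine (Finset.sum_le_sum fun j _ => hterm j).trans ?_
      rw [Finset.sum_coe_sort J (fun j => if (fun i => (k i).natAbs.size) = j then M ^ 2 else 0),
        Finset.sum_ite_eq]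
      split_ifs
      exacts [le_rfl, zero_le]
    exact (ENNReal.pow_le_pow_left_iff two_ne_zero).1 h2
  refine (lintegral_congr fun x => congrArg (· ^ P) (hsq x)).trans_le ((hC _ T c).trans ?_)
  gcongr
  rw [← ENNReal.tsum_mul_left]
  refine le_trans (Finset.sum_le_sum fun k _ => ?_) (ENNReal.sum_le_tsum B)
  calc _ ≤ ENNReal.ofReal (wt d k ^ (P - 2)) * (ENNReal.ofReal ((2 ^ d) ^ r) *
      (ENNReal.ofReal (wt d k ^ r) * ‖fCoeff d f k‖ₑ)) ^ P := by gcongr; exact hcnorm k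
    _ = _ := by
      rw [← ofReal_wt_mul_rpow d k r hP0, ENNReal.mul_rpow_of_nonneg _ _ hP0.le]
      ring

lemma continuous_blockProj (d : ℕ) (f : (Fin d → ℝ) → ℂ) (j : Fin d → ℕ) :
    Continuous (blockProj d f j) :=
  continuous_finsetSum _ fun k _ => continuous_const.mul (continuous_expk d k)

lemma tendsto_piFinset_range (d : ℕ) :
    Filter.Tendsto (fun n => Fintype.piFinset (fun _ : Fin d => Finset.range n))
      Filter.atTop Filter.atTop := by
  refine Filter.tendsto_atTop_finset_of_monotone (fun m n h => ?_) fun j => ?_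
  · exact Fintype.piFinset_subset _ _ fun _ => Finset.range_mono h
  · refine ⟨(Finset.univ.sup j) + 1, Fintype.mem_piFinset.2 fun i => Finset.mem_range.2 ?_⟩
    exact Nat.lt_succ_of_le (Finset.le_sup (Finset.mem_univ i))

lemma lintegral_tsum_square_function_le (d : ℕ) {P : ℝ} (hP : 0 ≤ P) (r : ℝ)
    (f : (Fin d → ℝ) → ℂ) {A : ℝ≥0∞}
    (h : ∀ n, ∫⁻ x in cube d, ((∑ j ∈ Fintype.piFinset (fun _ : Fin d => Finset.range n),
        (ENNReal.ofReal ((2:ℝ) ^ (((∑ i, j i : ℕ) : ℝ) * r)) * ‖blockProj d f j x‖ₑ) ^ 2)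
          ^ ((1:ℝ) / 2)) ^ P ≤ A) :
    ∫⁻ x in cube d, ((∑' j : Fin d → ℕ,
        (ENNReal.ofReal ((2:ℝ) ^ (((∑ i, j i : ℕ) : ℝ) * r)) * ‖blockProj d f j x‖ₑ) ^ 2)
          ^ ((1:ℝ) / 2)) ^ P ≤ A := by
  refine le_of_tendsto' (lintegral_tendsto_of_tendsto_of_monotone (fun n => ?_) ?_ ?_) h
  · refine Measurable.aemeasurable (Measurable.pow_const (Measurable.pow_const ?_ _) _)
    exact Finset.measurable_sum _ fun j _ =>
      ((continuous_blockProj d f j).enorm.measurable.const_mul _).pow_const 2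
  · refine Filter.Eventually.of_forall fun x m n hmn => ?_
    have := Fintype.piFinset_subset _ _ fun _ : Fin d => Finset.range_mono hmn
    dsimp only
    gcongr
  · refine Filter.Eventually.of_forall fun x => ?_
    refine ((ENNReal.continuous_rpow_const).tendsto _).comp
      (((ENNReal.continuous_rpow_const).tendsto _).comp ?_)
    exact ENNReal.summable.hasSum.comp (tendsto_piFinset_range d)

lemma expk_eq_prod_echar (d : ℕ) (k : Fin d → ℤ) (x : Fin d → ℝ) :
    expk d k x = ∏ i, echar (k i) (x i) := by
  unfold expk echar
  rw [← Complex.exp_sum]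
  congr 1
  push_cast
  rw [Finset.mul_sum, Finset.sum_mul]

lemma mFourier_coe (d : ℕ) (k : Fin d → ℤ) (x : Fin d → ℝ) :
    UnitAddTorus.mFourier k (fun i => (x i : UnitAddCircle)) = expk d k x := by
  rw [expk_eq_prod_echar]
  change ∏ i, fourier (k i) (x i : UnitAddCircle) = _
  refine Finset.prod_congr rfl fun i _ => ?_
  rw [fourier_coe_apply, echar]
  congr 1
  push_cast
  ring

/-- A continuous function on the torus extending a function supported inside the open cube. -/
lemma exists_continuousMap_torus (d : ℕ) {g : (Fin d → ℝ) → ℝ} (hg : Continuous g)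
    (hc : HasCompactSupport g) (hs : tsupport g ⊆ Set.univ.pi fun _ => Set.Ioo (0:ℝ) 1) :
    ∃ φ : C(UnitAddTorus (Fin d), ℂ), ∀ x ∈ cube d, φ (fun i => (x i : UnitAddCircle)) = g x := by
  set q : (Fin d → ℝ) → UnitAddTorus (Fin d) := fun x i => (x i : UnitAddCircle) with hq
  have hqc : Continuous q :=
    continuous_pi fun i => (AddCircle.continuous_mk' 1).comp (continuous_apply i)
  set s : UnitAddTorus (Fin d) → (Fin d → ℝ) := fun y i => (AddCircle.equivIco 1 0 (y i) : ℝ) with hs'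
  have hqs : ∀ y, q (s y) = y := fun y => funext fun i => AddCircle.coe_equivIco
  have hsq : ∀ x ∈ cube d, s (q x) = x := fun x hx => funext fun i =>
    AddCircle.equivIco_coe_of_mem (by simpa using hx i (Set.mem_univ i))
  have hK : IsCompact (q '' tsupport g) := hc.isCompact.image hqc
  have hcont : Continuous fun y => (g (s y) : ℂ) := by
    rw [continuous_iff_continuousAt]
    intro y
    by_cases hy : y ∈ q '' tsupport g
    · obtain ⟨x, hx, rfl⟩ := hy
      have hsc : ContinuousAt s (q x) := by
        refine continuousAt_pi.2 fun i => ?_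
        have hxi := hs hx i (Set.mem_univ i)
        have hne : (x i : UnitAddCircle) ≠ ((0:ℝ) : UnitAddCircle) := by
          intro h
          have h2 := congrArg (fun z => (AddCircle.equivIco 1 0 z : ℝ)) h
          rw [AddCircle.equivIco_coe_of_mem (by simpa using ⟨hxi.1.le, hxi.2⟩),
            AddCircle.equivIco_coe_of_mem (by simp)] at h2
          exact hxi.1.ne' h2
        exact continuous_subtype_val.continuousAt.comp
          (ContinuousAt.comp (f := fun y : UnitAddTorus (Fin d) => y i) (x := q x)
            (AddCircle.continuousAt_equivIco 1 0 hne) (continuous_apply i).continuousAt)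
      exact Complex.continuous_ofReal.continuousAt.comp (hg.continuousAt.comp hsc)
    · have hev : (fun y => (g (s y) : ℂ)) =ᶠ[nhds y] fun _ => 0 := by
        filter_upwards [hK.isClosed.isOpen_compl.mem_nhds hy] with z hz
        have : s z ∉ tsupport g := fun h => hz ⟨s z, h, hqs z⟩
        rw [image_eq_zero_of_notMem_tsupport this, Complex.ofReal_zero]
      exact continuousAt_const.congr hev.symm
  refine ⟨⟨_, hcont⟩, fun x hx => ?_⟩
  exact congrArg (fun z => (g z : ℂ)) (hsq x hx)

lemma integral_mul_torus_eq_zero (d : ℕ) {h : (Fin d → ℝ) → ℂ} (hi : IntegrableOn h (cube d))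
    (h0 : ∀ k, fCoeff d h k = 0) (φ : C(UnitAddTorus (Fin d), ℂ)) :
    ∫ x in cube d, φ (fun i => (x i : UnitAddCircle)) * h x = 0 := by
  have hqc : Continuous fun (x : Fin d → ℝ) (i : Fin d) => (x i : UnitAddCircle) :=
    continuous_pi fun i => (AddCircle.continuous_mk' 1).comp (continuous_apply i)
  have hint : ∀ φ : C(UnitAddTorus (Fin d), ℂ),
      IntegrableOn (fun x => φ (fun i => (x i : UnitAddCircle)) * h x) (cube d) := fun φ =>
    hi.bdd_mul (c := ‖φ‖) (φ.continuous.comp hqc).aestronglyMeasurable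
      (Filter.Eventually.of_forall fun x => φ.norm_coe_le_norm _)
  let L : C(UnitAddTorus (Fin d), ℂ) →ₗ[ℂ] ℂ :=
    { toFun := fun φ => ∫ x in cube d, φ (fun i => (x i : UnitAddCircle)) * h x
      map_add' := fun φ ψ => by
        rw [← integral_add (hint φ) (hint ψ)]
        simp [add_mul]
      map_smul' := fun a φ => by
        rw [RingHom.id_apply, smul_eq_mul, ← integral_const_mul]
        simp [mul_assoc] }
  let L' : C(UnitAddTorus (Fin d), ℂ) →L[ℂ] ℂ := L.mkContinuous (∫ x in cube d, ‖h x‖) fun φ => by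
    refine (norm_integral_le_integral_norm _).trans ?_
    rw [mul_comm, ← integral_const_mul]
    refine integral_mono (hint φ).norm (hi.norm.const_mul _) fun x => ?_
    rw [norm_mul]
    exact mul_le_mul_of_nonneg_right (φ.norm_coe_le_norm _) (norm_nonneg _)
  have hker : (Submodule.span ℂ (Set.range (UnitAddTorus.mFourier (d := Fin d)))).topologicalClosure
      ≤ LinearMap.ker L'.toLinearMap := by
    refine Submodule.topologicalClosure_minimal _ ?_ L'.isClosed_ker
    rw [Submodule.span_le]
    rintro _ ⟨k, rfl⟩
    have hk := h0 (-k)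
    simp only [fCoeff, neg_neg] at hk
    change ∫ x in cube d, UnitAddTorus.mFourier k (fun i => (x i : UnitAddCircle)) * h x = 0
    simp_rw [mFourier_coe, mul_comm _ (h _)]
    exact hk
  rw [UnitAddTorus.span_mFourier_closure_eq_top] at hker
  exact hker (Submodule.mem_top (x := φ))

/-- An integrable function on the torus is determined by its Fourier coefficients. -/
lemma ae_eq_zero_of_fCoeff_eq_zero (d : ℕ) {h : (Fin d → ℝ) → ℂ} (hi : IntegrableOn h (cube d))
    (h0 : ∀ k, fCoeff d h k = 0) : ∀ᵐ x ∂volume.restrict (cube d), h x = 0 := by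
  set U : Set (Fin d → ℝ) := Set.univ.pi fun _ => Set.Ioo (0:ℝ) 1
  have hU : IsOpen U := isOpen_set_pi Set.finite_univ fun _ _ => isOpen_Ioo
  have hUc : U ⊆ cube d := Set.pi_mono fun _ _ => Set.Ioo_subset_Ico_self
  have hae : cube d =ᵐ[volume] U :=
    (Measure.univ_pi_Ico_ae_eq_Icc (μ := fun _ => volume)).trans
      (Measure.univ_pi_Ioo_ae_eq_Icc (μ := fun _ => volume)).symm
  have hae0 : ∀ᵐ x ∂(volume : Measure (Fin d → ℝ)), x ∈ U → h x = 0 := by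
    refine hU.ae_eq_zero_of_integral_contDiff_smul_eq_zero
      (hi.mono_set hUc).locallyIntegrableOn fun g hg hgc hgs => ?_
    obtain ⟨φ, hφ⟩ := exists_continuousMap_torus d hg.continuous hgc hgs
    have hm : MeasurableSet (cube d) := MeasurableSet.univ_pi fun _ => measurableSet_Ico
    rw [← setIntegral_eq_integral_of_forall_compl_eq_zero (s := cube d),
      ← integral_mul_torus_eq_zero d hi h0 φ]
    · refine setIntegral_congr_fun hm fun x hx => ?_
      simp only [hφ x hx, Complex.real_smul]
    · intro x hx
      rw [image_eq_zero_of_notMem_tsupport fun hx' => hx (hUc (hgs hx')), zero_smul]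
  rw [Measure.restrict_congr_set hae, ae_restrict_iff' hU.measurableSet]
  exact hae0

instance (d : ℕ) : IsProbabilityMeasure ((volume : Measure (Fin d → ℝ)).restrict (cube d)) := by
  have : IsProbabilityMeasure ((volume : Measure ℝ).restrict (Set.Ico 0 1)) := ⟨by simp⟩
  rw [restrict_cube]
  infer_instance

lemma expk_mul_expk (d : ℕ) (k l : Fin d → ℤ) (x : Fin d → ℝ) :
    expk d k x * expk d l x = expk d (k + l) x := by
  unfold expk
  rw [← Complex.exp_add]
  congr 1
  simp only [Pi.add_apply, Int.cast_add, add_mul, Finset.sum_add_distrib]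
  push_cast
  ring

lemma integral_expk (d : ℕ) (k : Fin d → ℤ) :
    ∫ x in cube d, expk d k x = if k = 0 then 1 else 0 := by
  simp_rw [expk_eq_prod_echar]
  rw [restrict_cube, integral_fintype_prod_eq_prod (𝕜 := ℂ) (fun i => echar (k i))]
  simp_rw [integral_echar]
  split_ifs with h
  · simp [h]
  · obtain ⟨i, hi⟩ := Function.ne_iff.1 h
    exact Finset.prod_eq_zero (Finset.mem_univ i) (if_neg hi)

lemma fCoeff_expk (d : ℕ) (k m : Fin d → ℤ) :
    fCoeff d (expk d k) m = if k = m then 1 else 0 := by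
  simp_rw [fCoeff, expk_mul_expk, integral_expk, add_neg_eq_zero]

lemma memLp_expk (d : ℕ) (k : Fin d → ℤ) (p : ℝ≥0∞) :
    MemLp (expk d k) p (volume.restrict (cube d)) :=
  MemLp.of_bound (continuous_expk d k).aestronglyMeasurable 1
    (Filter.Eventually.of_forall fun x => (norm_expk d k x).le)

/-- The character `expk d k` as an element of `L_p`. -/
def expkLp (d : ℕ) (p : ℝ≥0∞) (k : Fin d → ℤ) : Lp ℂ p (volume.restrict (cube d)) :=
  (memLp_expk d k p).toLp _

lemma coeFn_sum_expkLp (d : ℕ) (p : ℝ≥0∞) (a : (Fin d → ℤ) → ℂ) (S : Finset (Fin d → ℤ)) :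
    (∑ k ∈ S, a k • expkLp d p k : Lp ℂ p (volume.restrict (cube d))) =ᵐ[volume.restrict (cube d)]
      fun x => ∑ k ∈ S, expk d k x • a k := by
  classical
  induction S using Finset.induction_on with
  | empty =>
    simp only [Finset.sum_empty]
    exact Lp.coeFn_zero ℂ p (volume.restrict (cube d))
  | insert k S hk ih =>
    rw [Finset.sum_insert hk]
    filter_upwards [ih, Lp.coeFn_add (a k • expkLp d p k) (∑ k ∈ S, a k • expkLp d p k),
      Lp.coeFn_smul (a k) (expkLp d p k), (memLp_expk d k p).coeFn_toLp] with x h1 h2 h3 h4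
    rw [h2, Pi.add_apply, h1, h3, Pi.smul_apply, expkLp, h4, Finset.sum_insert hk, smul_eq_mul,
      smul_eq_mul, mul_comm]

/-- The `m`-th Fourier coefficient as a continuous linear functional on `L_p`. -/
lemma exists_fCoeff_clm (d : ℕ) (p : ℝ≥0∞) [Fact (1 ≤ p)] (m : Fin d → ℤ) :
    ∃ L : Lp ℂ p (volume.restrict (cube d)) →L[ℂ] ℂ, ∀ g, L g = fCoeff d g m := by
  have : Fact (1 ≤ p.conjExponent) := ⟨ENNReal.HolderConjugate.one_le p.conjExponent p⟩
  refine ⟨((ContinuousLinearMap.mul ℂ ℂ).lpPairing (volume.restrict (cube d)) p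
    p.conjExponent).flip (expkLp d _ (-m)), fun g => ?_⟩
  rw [ContinuousLinearMap.flip_apply, ContinuousLinearMap.lpPairing_eq_integral, fCoeff]
  refine integral_congr_ae ?_
  filter_upwards [(memLp_expk d (-m) p.conjExponent).coeFn_toLp] with x hx
  rw [ContinuousLinearMap.mul_apply', expkLp, hx]

lemma fCoeff_expkLp (d : ℕ) (p : ℝ≥0∞) (k m : Fin d → ℤ) :
    fCoeff d (expkLp d p k) m = if k = m then 1 else 0 := by
  rw [← fCoeff_expk]
  refine integral_congr_ae ?_
  filter_upwards [(memLp_expk d k p).coeFn_toLp] with x hx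
  rw [expkLp, hx]

lemma enorm_rpow_Lp {d : ℕ} {p : ℝ≥0∞} (hp0 : p ≠ 0) (hp : p ≠ ∞)
    (g : Lp ℂ p (volume.restrict (cube d))) :
    ‖g‖ₑ ^ p.toReal = ∫⁻ x in cube d, ‖g x‖ₑ ^ p.toReal := by
  rw [Lp.enorm_def, eLpNorm_eq_lintegral_rpow_enorm_toReal hp0 hp, ← ENNReal.rpow_mul,
    one_div_mul_cancel (ENNReal.toReal_pos hp0 hp).ne', ENNReal.rpow_one]

/-- An integrable function satisfies the Hardy–Littlewood inequality as soon as trigonometric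
polynomials do. -/
lemma lintegral_enorm_rpow_le (d : ℕ) {p : ℝ≥0∞} [Fact (1 ≤ p)] (hp : p ≠ ∞)
    {C : ℝ≥0∞} (hCtop : C ≠ ∞)
    (hC : ∀ (T : Finset ℤ) (c : (Fin d → ℤ) → ℂ), ∫⁻ x in cube d,
        ‖∑ k ∈ Fintype.piFinset (fun _ : Fin d => T), expk d k x • c k‖ₑ ^ p.toReal ≤
      C * ∑ k ∈ Fintype.piFinset (fun _ : Fin d => T),
        ENNReal.ofReal (wt d k ^ (p.toReal - 2)) * ‖c k‖ₑ ^ p.toReal)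
    {f : (Fin d → ℝ) → ℂ} (hf : IntegrableOn f (cube d))
    (hA : ∑' k, ENNReal.ofReal (wt d k ^ (p.toReal - 2)) * ‖fCoeff d f k‖ₑ ^ p.toReal ≠ ∞) :
    ∫⁻ x in cube d, ‖f x‖ₑ ^ p.toReal ≤
      C * ∑' k, ENNReal.ofReal (wt d k ^ (p.toReal - 2)) * ‖fCoeff d f k‖ₑ ^ p.toReal := by
  classical
  have hp0 : p ≠ 0 := (zero_lt_one.trans_le Fact.out).ne'
  have hP : 0 < p.toReal := ENNReal.toReal_pos hp0 hp
  set w : (Fin d → ℤ) → ℝ≥0∞ := fun k =>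
    ENNReal.ofReal (wt d k ^ (p.toReal - 2)) * ‖fCoeff d f k‖ₑ ^ p.toReal with hw
  set u : (Fin d → ℤ) → Lp ℂ p (volume.restrict (cube d)) := fun k =>
    fCoeff d f k • expkLp d p k with hu
  have hfin : ∀ S : Finset (Fin d → ℤ), ‖∑ k ∈ S, u k‖ₑ ^ p.toReal ≤ C * ∑ k ∈ S, w k := by
    intro S
    set T : Finset ℤ := S.biUnion fun k => Finset.univ.image k
    have hST : S ⊆ Fintype.piFinset (fun _ : Fin d => T) := fun k hk =>
      Fintype.mem_piFinset.2 fun i => Finset.mem_biUnion.2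
        ⟨k, hk, Finset.mem_image_of_mem k (Finset.mem_univ i)⟩
    have h := hC T fun k => if k ∈ S then fCoeff d f k else 0
    have h1 : ∀ x, ∑ k ∈ Fintype.piFinset (fun _ : Fin d => T),
        expk d k x • (if k ∈ S then fCoeff d f k else 0) = ∑ k ∈ S, expk d k x • fCoeff d f k := by
      intro x
      rw [← Finset.sum_subset hST fun k _ hk => by rw [if_neg hk, smul_zero]]
      exact Finset.sum_congr rfl fun k hk => by rw [if_pos hk]
    have h2 : ∑ k ∈ Fintype.piFinset (fun _ : Fin d => T),
        ENNReal.ofReal (wt d k ^ (p.toReal - 2)) *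
          ‖if k ∈ S then fCoeff d f k else 0‖ₑ ^ p.toReal = ∑ k ∈ S, w k := by
      rw [← Finset.sum_subset hST fun k _ hk => by
        rw [if_neg hk, enorm_zero, ENNReal.zero_rpow_of_pos hP, mul_zero]]
      exact Finset.sum_congr rfl fun k hk => by rw [if_pos hk]
    simp_rw [h1, h2] at h
    rw [enorm_rpow_Lp hp0 hp]
    refine (lintegral_congr_ae ?_).trans_le h
    filter_upwards [coeFn_sum_expkLp d p (fCoeff d f) S] with x hx
    rw [hx]
  have hsum : Summable u := by
    rw [summable_iff_vanishing_norm]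
    intro ε hε
    have hlim : Filter.Tendsto (fun S : Finset (Fin d → ℤ) =>
        C * ∑' k : { k // k ∉ S }, w k) Filter.atTop (nhds 0) := by
      simpa using ENNReal.Tendsto.const_mul (ENNReal.tendsto_tsum_compl_atTop_zero hA)
        (Or.inr hCtop)
    have hε' : 0 < ENNReal.ofReal ε ^ p.toReal :=
      ENNReal.rpow_pos (ENNReal.ofReal_pos.2 hε) ENNReal.ofReal_ne_top
    obtain ⟨S, hS⟩ := (hlim.eventually_lt_const hε').exists
    refine ⟨S, fun t ht => ?_⟩
    have h1 : ∑ k ∈ t, w k ≤ ∑' k : { k // k ∉ S }, w k := by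
      rw [← Finset.tsum_subtype]
      exact ENNReal.tsum_mono_subtype w fun k hk => Finset.disjoint_left.1 ht hk
    have h2 : ‖∑ k ∈ t, u k‖ₑ < ENNReal.ofReal ε := by
      rw [← ENNReal.rpow_lt_rpow_iff hP]
      exact ((hfin t).trans (mul_le_mul_right h1 C)).trans_lt hS
    rwa [← ofReal_norm, ENNReal.ofReal_lt_ofReal_iff hε] at h2
  obtain ⟨g, hg⟩ := hsum
  have hgint : Integrable g (volume.restrict (cube d)) := (Lp.memLp g).integrable Fact.out
  have hcoef : ∀ m, fCoeff d g m = fCoeff d f m := by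
    intro m
    obtain ⟨L, hL⟩ := exists_fCoeff_clm d p m
    have h1 := L.hasSum hg
    have h2 : HasSum (fun k => L (u k)) (fCoeff d f m) := by
      convert hasSum_ite_eq m (fCoeff d f m) using 2 with k
      rw [hu, map_smul, hL, fCoeff_expkLp, smul_eq_mul, mul_ite, mul_one, mul_zero]
      split_ifs with h
      · rw [h]
      · rfl
    rw [← hL, h1.unique h2]
  have hae : ∀ᵐ x ∂volume.restrict (cube d), f x - g x = 0 := by
    refine ae_eq_zero_of_fCoeff_eq_zero d (h := fun x => f x - g x) (hf.sub hgint) fun k => ?_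
    have hmul : ∀ h : (Fin d → ℝ) → ℂ, Integrable h (volume.restrict (cube d)) →
        Integrable (fun x => h x * expk d (-k) x) (volume.restrict (cube d)) := fun h hh =>
      hh.mul_bdd (c := 1) (continuous_expk d (-k)).aestronglyMeasurable
        (Filter.Eventually.of_forall fun x => (norm_expk d (-k) x).le)
    have h := hcoef k
    simp only [fCoeff, sub_mul] at h ⊢
    rw [integral_sub (hmul f hf) (hmul g hgint), h, sub_self]
  have hfg : ∫⁻ x in cube d, ‖f x‖ₑ ^ p.toReal = ‖g‖ₑ ^ p.toReal := by
    rw [enorm_rpow_Lp hp0 hp]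
    refine lintegral_congr_ae ?_
    filter_upwards [hae] with x hx
    rw [sub_eq_zero.1 hx]
  rw [hfg]
  refine le_of_tendsto (((ENNReal.continuous_rpow_const (y := p.toReal)).tendsto _).comp
    hg.enorm) (Filter.Eventually.of_forall fun S => ?_)
  exact (hfin S).trans (mul_le_mul_right (ENNReal.sum_le_tsum S) C)

/-- the embedding `S^{r+1-2/p}_p A ↪ S^r_p W`
for `2 ≤ p < ∞`, `r ≥ 0`. -/
theorem statement11 (d : ℕ) (hd : 1 ≤ d) (p : ℝ≥0∞) (hp1 : 2 ≤ p) (hp2 : p ≠ ∞)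
    (r : ℝ) (hr : 0 ≤ r) :
    ∃ C : ℝ, 0 < C ∧ ∀ f : (Fin d → ℝ) → ℂ, IntegrableOn f (cube d) →
      sobolevNorm d r p f ≤
        ENNReal.ofReal C * wienerNorm d (r + 1 - 2/p.toReal) p f := by
  have : Fact (1 ≤ p) := ⟨one_le_two.trans hp1⟩
  have hp0 : p ≠ 0 := (two_pos.trans_le hp1).ne'
  have hP : 2 ≤ p.toReal := by simpa using ENNReal.toReal_mono hp2 hp1
  have hP0 : 0 < p.toReal := by linarith
  obtain ⟨C, hCtop, hC⟩ := exists_lintegral_enorm_rpow_sum_expk_le d hP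
  set D := C * ENNReal.ofReal ((2 ^ d) ^ r) ^ p.toReal with hD
  have hDtop : D ≠ ∞ :=
    ENNReal.mul_ne_top hCtop (ENNReal.rpow_ne_top_of_nonneg hP0.le ENNReal.ofReal_ne_top)
  have hDtop' : D ^ (1 / p.toReal) ≠ ∞ := ENNReal.rpow_ne_top_of_nonneg (by positivity) hDtop
  refine ⟨(D ^ (1 / p.toReal)).toReal + 1, by positivity, fun f hf => ?_⟩
  set A := ∑' k, (ENNReal.ofReal (wt d k ^ (r + 1 - 2 / p.toReal)) * ‖fCoeff d f k‖ₑ) ^ p.toReal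
    with hA
  have hW : wienerNorm d (r + 1 - 2 / p.toReal) p f = A ^ (1 / p.toReal) := if_neg hp2
  have hDle : D ^ (1 / p.toReal) ≤ ENNReal.ofReal ((D ^ (1 / p.toReal)).toReal + 1) := by
    rw [← ENNReal.ofReal_toReal hDtop']
    exact ENNReal.ofReal_le_ofReal (by simp)
  rw [hW]
  rcases eq_or_ne A ∞ with hAtop | hAtop
  · rw [hAtop, ENNReal.top_rpow_of_pos (by positivity),
      ENNReal.mul_top (ENNReal.ofReal_pos.2 (by positivity)).ne']
    exact le_top
  suffices h : ∃ I : ℝ≥0∞, sobolevNorm d r p f = I ^ (1 / p.toReal) ∧ I ≤ D * A by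
    obtain ⟨I, hI, hIle⟩ := h
    rw [hI]
    calc I ^ (1 / p.toReal) ≤ (D * A) ^ (1 / p.toReal) := by gcongr
      _ = D ^ (1 / p.toReal) * A ^ (1 / p.toReal) :=
        ENNReal.mul_rpow_of_nonneg _ _ (by positivity)
      _ ≤ _ := by gcongr
  rcases eq_or_ne r 0 with rfl | hr0
  · have hAeq : A = ∑' k, ENNReal.ofReal (wt d k ^ (p.toReal - 2)) *
        ‖fCoeff d f k‖ₑ ^ p.toReal := by
      refine tsum_congr fun k => ?_
      rw [← ofReal_wt_mul_rpow d k 0 hP0, Real.rpow_zero, ENNReal.ofReal_one, one_mul]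
    refine ⟨∫⁻ x in cube d, ‖f x‖ₑ ^ p.toReal, ?_, ?_⟩
    · rw [sobolevNorm, if_pos rfl, LqNorm, eLpNorm_eq_lintegral_rpow_enorm_toReal hp0 hp2]
    · rw [hD, Real.rpow_zero, ENNReal.ofReal_one, ENNReal.one_rpow, mul_one, hAeq]
      exact lintegral_enorm_rpow_le d hp2 hCtop (hC ℂ) hf (hAeq ▸ hAtop)
  · refine ⟨_, if_neg hr0, ?_⟩
    rw [hD, mul_assoc]
    exact lintegral_tsum_square_function_le d hP0.le r f
      fun n => lintegral_square_function_le d hP hr hC f n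

end Paper
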